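/- For every ε ∈ (0,1) there exist constants c > 0 and C > 0 such that for all integers n ≥ 2, all Δ ∈ (0, 1-ε], and all horizons t ∈ ℕ with t ≤ n/Δ², there exists an interactive algorithm that simultaneously satisfies: (i) its success probability P(a_{t+1} = a*) ≥ c·(1 + tΔ²)/n, and (ii) its mutual information I(a*; H_t) ≤ C·(1 + tΔ²)·log(2 + tΔ²)/n. -/

import Mathlib

open scoped BigOperators

noncomputable section

/-- Probability that pulling arm `a` yields reward `r : Bool` (with `true` = reward 1),
when the best arm is `astar`: `Bernoulli ((1+Δ)/2)` if `a = astar`, else `Bernoulli ((1-Δ)/2)`. -/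
def rewP (n : ℕ) (Δ : ℝ) (astar a : Fin n) (r : Bool) : ℝ :=
  if r then (if a = astar then (1 + Δ) / 2 else (1 - Δ) / 2)
  else 1 - (if a = astar then (1 + Δ) / 2 else (1 - Δ) / 2)

/-- An interactive algorithm: for every history (recorded with the most recent pull first),
a probability distribution over the `n` arms used to draw the next pull. -/
def IsAlg (n : ℕ) (alg : List (Fin n × Bool) → Fin n → ℝ) : Prop :=
  ∀ h : List (Fin n × Bool), (∀ a, 0 ≤ alg h a) ∧ (∑ a : Fin n, alg h a) = 1

/-- Probability, conditionally on the best arm `astar`, of observing a given history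
(recorded with the most recent pull first) when running the algorithm `alg`. -/
def histP (n : ℕ) (alg : List (Fin n × Bool) → Fin n → ℝ) (Δ : ℝ) (astar : Fin n) :
    List (Fin n × Bool) → ℝ
  | [] => 1
  | (a, r) :: prev => histP n alg Δ astar prev * alg prev a * rewP n Δ astar a r

/-- The reversed history (most recent pull first) associated with a tuple of `t` pulls. -/
def hist {n t : ℕ} (h : Fin t → Fin n × Bool) : List (Fin n × Bool) :=
  (List.ofFn h).reverse

/-- Success probability `P(a_{t+1} = a*)` of an interactive algorithm after `t` rounds,
under the uniform prior on the best arm. -/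
def succProb (n t : ℕ) (alg : List (Fin n × Bool) → Fin n → ℝ) (Δ : ℝ) : ℝ :=
  ((n : ℝ))⁻¹ * ∑ astar : Fin n, ∑ h : Fin t → Fin n × Bool,
    histP n alg Δ astar (hist h) * alg (hist h) astar

/-- Mutual information (in nats) `I(a*; H_t)` accumulated by an interactive algorithm. -/
def mutualInfo (n t : ℕ) (alg : List (Fin n × Bool) → Fin n → ℝ) (Δ : ℝ) : ℝ :=
  ∑ astar : Fin n, ∑ h : Fin t → Fin n × Bool,
    ((n : ℝ))⁻¹ * histP n alg Δ astar (hist h) *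
      Real.log (histP n alg Δ astar (hist h) /
        (((n : ℝ))⁻¹ * ∑ b : Fin n, histP n alg Δ b (hist h)))

/-- Optimal success probability `p*_t`. -/
def pStar (n t : ℕ) (Δ : ℝ) : ℝ :=
  sSup {x : ℝ | ∃ alg, IsAlg n alg ∧ x = succProb n t alg Δ}

/-- Optimal mutual information `I*_t`. -/
def IStar (n t : ℕ) (Δ : ℝ) : ℝ :=
  sSup {x : ℝ | ∃ alg, IsAlg n alg ∧ x = mutualInfo n t alg Δ}

section BanditWalk

open Finset

/-- Weight of a history (most recent pull first) when arm `c` has reward law `rew c`. -/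
def pathP {n : ℕ} (alg : List (Fin n × Bool) → Fin n → ℝ) (rew : Fin n → Bool → ℝ) :
    List (Fin n × Bool) → ℝ
  | [] => 1
  | (c, r) :: h => pathP alg rew h * alg h c * rew c r

/-- Expectation of a function of the history after `s` pulls. -/
def pathE {n : ℕ} (alg : List (Fin n × Bool) → Fin n → ℝ) (rew : Fin n → Bool → ℝ) (s : ℕ)
    (φ : List (Fin n × Bool) → ℝ) : ℝ :=
  ∑ h : Fin s → Fin n × Bool, pathP alg rew (hist h) * φ (hist h)

/-- Conditional expectation of a function of the next history given the current one. -/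
def stepE {n : ℕ} (alg : List (Fin n × Bool) → Fin n → ℝ) (rew : Fin n → Bool → ℝ)
    (φ : List (Fin n × Bool) → ℝ) (h : List (Fin n × Bool)) : ℝ :=
  ∑ c, alg h c * ∑ r, rew c r * φ ((c, r) :: h)

/-- A reward law for each arm. -/
def IsRew {n : ℕ} (rew : Fin n → Bool → ℝ) : Prop :=
  ∀ c, (∀ r, 0 ≤ rew c r) ∧ ∑ r, rew c r = 1

section Paths

variable {n : ℕ} {alg : List (Fin n × Bool) → Fin n → ℝ} {rew : Fin n → Bool → ℝ}

lemma length_hist {s : ℕ} (h : Fin s → Fin n × Bool) : (hist h).length = s := by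
  simp [hist]

lemma sum_hist_succ (s : ℕ) (φ : List (Fin n × Bool) → ℝ) :
    ∑ h : Fin (s + 1) → Fin n × Bool, φ (hist h) =
      ∑ h : Fin s → Fin n × Bool, ∑ x : Fin n × Bool, φ (x :: hist h) := by
  rw [← (Fin.snocEquiv (fun _ : Fin (s + 1) => Fin n × Bool)).sum_comp, Fintype.sum_prod_type,
    Finset.sum_comm]
  refine Finset.sum_congr rfl fun h _ => Finset.sum_congr rfl fun x _ => ?_
  rw [hist, List.ofFn_succ', List.concat_eq_append, List.reverse_append]
  simp [hist]

lemma histP_eq_pathP (Δ : ℝ) (a : Fin n) (h : List (Fin n × Bool)) :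
    histP n alg Δ a h = pathP alg (rewP n Δ a) h := by
  induction h with
  | nil => rfl
  | cons x h ih => simp [histP, pathP, ih]

lemma pathP_nonneg (halg : IsAlg n alg) (hrew : IsRew rew) (h : List (Fin n × Bool)) :
    0 ≤ pathP alg rew h := by
  induction h with
  | nil => simp [pathP]
  | cons x h ih => exact mul_nonneg (mul_nonneg ih ((halg h).1 _)) ((hrew _).1 _)

lemma pathE_zero (φ : List (Fin n × Bool) → ℝ) : pathE alg rew 0 φ = φ [] := by
  simp [pathE, hist, pathP]

lemma pathE_succ (s : ℕ) (φ : List (Fin n × Bool) → ℝ) :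
    pathE alg rew (s + 1) φ = pathE alg rew s (stepE alg rew φ) := by
  unfold pathE
  rw [sum_hist_succ s fun h => pathP alg rew h * φ h]
  refine Finset.sum_congr rfl fun h _ => ?_
  simp only [stepE, Fintype.sum_prod_type, Finset.mul_sum, pathP]
  refine Finset.sum_congr rfl fun c _ => Finset.sum_congr rfl fun r _ => ?_
  ring

lemma pathE_mono (halg : IsAlg n alg) (hrew : IsRew rew) {s : ℕ}
    {φ ψ : List (Fin n × Bool) → ℝ} (h : ∀ l, l.length = s → φ l ≤ ψ l) :
    pathE alg rew s φ ≤ pathE alg rew s ψ :=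
  Finset.sum_le_sum fun l _ =>
    mul_le_mul_of_nonneg_left (h _ (length_hist l)) (pathP_nonneg halg hrew _)

lemma pathE_add (s : ℕ) (φ ψ : List (Fin n × Bool) → ℝ) :
    pathE alg rew s (fun h => φ h + ψ h) = pathE alg rew s φ + pathE alg rew s ψ := by
  simp [pathE, mul_add, Finset.sum_add_distrib]

lemma pathE_mul_const (s : ℕ) (φ : List (Fin n × Bool) → ℝ) (v : ℝ) :
    pathE alg rew s (fun h => φ h * v) = pathE alg rew s φ * v := by
  simp [pathE, ← mul_assoc, Finset.sum_mul]

lemma stepE_of_eq (halg : IsAlg n alg) (hrew : IsRew rew) {φ : List (Fin n × Bool) → ℝ}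
    {h : List (Fin n × Bool)} {v : ℝ} (hv : ∀ x, φ (x :: h) = v) : stepE alg rew φ h = v := by
  simp only [stepE, hv, ← Finset.sum_mul, (hrew _).2, one_mul, (halg h).2]

lemma pathE_const (halg : IsAlg n alg) (hrew : IsRew rew) (s : ℕ) (v : ℝ) :
    pathE alg rew s (fun _ => v) = v := by
  induction s with
  | zero => exact pathE_zero _
  | succ s ih =>
    rw [pathE_succ]
    convert ih using 2
    exact funext fun h => stepE_of_eq halg hrew fun _ => rfl

lemma le_pathE_of_submartingale (halg : IsAlg n alg) (hrew : IsRew rew) {t : ℕ}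
    {ψ : List (Fin n × Bool) → ℝ} (h : ∀ l, l.length < t → ψ l ≤ stepE alg rew ψ l) :
    ψ [] ≤ pathE alg rew t ψ := by
  induction t with
  | zero => rw [pathE_zero]
  | succ t ih =>
    rw [pathE_succ]
    exact (ih fun l hl => h l (by omega)).trans
      (pathE_mono halg hrew fun l hl => h l (by omega))

lemma sum_pathE_le_of_drift (halg : IsAlg n alg) (hrew : IsRew rew) {t : ℕ} {v : ℝ}
    {ψ φ : List (Fin n × Bool) → ℝ}
    (h : ∀ l, l.length < t → stepE alg rew ψ l + φ l ≤ ψ l + v) :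
    pathE alg rew t ψ + ∑ s ∈ range t, pathE alg rew s φ ≤ ψ [] + t * v := by
  induction t with
  | zero => simp [pathE_zero]
  | succ t ih =>
    have h1 := ih fun l hl => h l (by omega)
    have h2 := pathE_mono halg hrew fun l (hl : l.length = t) => h l (by omega)
    rw [pathE_add, pathE_add, pathE_const halg hrew, ← pathE_succ] at h2
    rw [Finset.sum_range_succ]
    push_cast
    linarith

end Paths

section Information

variable {n : ℕ} {alg : List (Fin n × Bool) → Fin n → ℝ} {Δ : ℝ}

/-- The reward law shared by all arms when no arm is optimal. -/
def baseRew (n : ℕ) (Δ : ℝ) (_ : Fin n) (r : Bool) : ℝ :=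
  if r then (1 - Δ) / 2 else (1 + Δ) / 2

/-- Log-likelihood ratio of a history between best arm `a` and no best arm. -/
def logLR {n : ℕ} (Δ : ℝ) (a : Fin n) : List (Fin n × Bool) → ℝ
  | [] => 0
  | (c, r) :: h => logLR Δ a h + Real.log (rewP n Δ a c r / baseRew n Δ c r)

lemma rewP_pos (h0 : 0 < Δ) (h1 : Δ < 1) (a c : Fin n) (r : Bool) : 0 < rewP n Δ a c r := by
  unfold rewP; split_ifs <;> linarith

lemma baseRew_pos (h0 : 0 < Δ) (h1 : Δ < 1) (c : Fin n) (r : Bool) : 0 < baseRew n Δ c r := by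
  unfold baseRew; split_ifs <;> linarith

lemma isRew_rewP (h0 : 0 < Δ) (h1 : Δ < 1) (a : Fin n) : IsRew (rewP n Δ a) :=
  fun c => ⟨fun r => (rewP_pos h0 h1 a c r).le, by simp [rewP]⟩

lemma isRew_baseRew (h0 : 0 < Δ) (h1 : Δ < 1) : IsRew (baseRew n Δ) :=
  fun c => ⟨fun r => (baseRew_pos h0 h1 c r).le, by simp [baseRew]; ring⟩

lemma pathP_rewP_eq (h0 : 0 < Δ) (h1 : Δ < 1) (a : Fin n) (h : List (Fin n × Bool)) :
    pathP alg (rewP n Δ a) h = pathP alg (baseRew n Δ) h * Real.exp (logLR Δ a h) := by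
  induction h with
  | nil => simp [pathP, logLR]
  | cons x h ih =>
    obtain ⟨c, r⟩ := x
    have hb := (baseRew_pos h0 h1 c r).ne'
    rw [pathP, pathP, logLR, Real.exp_add,
      Real.exp_log (div_pos (rewP_pos h0 h1 a c r) (baseRew_pos h0 h1 c r)), ih]
    field_simp

lemma stepE_logLR (halg : IsAlg n alg) (h0 : 0 < Δ) (h1 : Δ < 1) (a : Fin n)
    (h : List (Fin n × Bool)) :
    stepE alg (rewP n Δ a) (logLR Δ a) h =
      logLR Δ a h + alg h a * (Δ * Real.log ((1 + Δ) / (1 - Δ))) := by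
  have key : ∀ c, ∑ r, rewP n Δ a c r * logLR Δ a ((c, r) :: h) =
      logLR Δ a h + if c = a then Δ * Real.log ((1 + Δ) / (1 - Δ)) else 0 := by
    intro c
    have hp : (0 : ℝ) < 1 - Δ := by linarith
    have hq : (0 : ℝ) < 1 + Δ := by linarith
    by_cases hc : c = a
    · have e1 : (1 + Δ) / 2 / ((1 - Δ) / 2) = (1 + Δ) / (1 - Δ) := by field_simp
      have e2 : (1 - (1 + Δ) / 2) / ((1 + Δ) / 2) = ((1 + Δ) / (1 - Δ))⁻¹ := by
        field_simp; ring
      simp only [logLR, rewP, baseRew, hc, Fintype.sum_bool, if_true, if_false,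
        Bool.false_eq_true, e1, e2, Real.log_inv]
      ring
    · have e2 : 1 - (1 - Δ) / 2 = (1 + Δ) / 2 := by ring
      have e3 : (1 - Δ) / 2 ≠ 0 := by positivity
      have e4 : (1 + Δ) / 2 ≠ 0 := by positivity
      simp only [logLR, rewP, baseRew, hc, e2, Fintype.sum_bool, if_true, if_false,
        Bool.false_eq_true, div_self e3, div_self e4, Real.log_one]
      ring
  simp only [stepE, key, mul_add, Finset.sum_add_distrib, ← Finset.sum_mul, (halg h).2]
  simp

lemma pathE_logLR (halg : IsAlg n alg) (h0 : 0 < Δ) (h1 : Δ < 1) (a : Fin n) (t : ℕ) :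
    pathE alg (rewP n Δ a) t (logLR Δ a) =
      (∑ s ∈ range t, pathE alg (rewP n Δ a) s fun h => alg h a) *
        (Δ * Real.log ((1 + Δ) / (1 - Δ))) := by
  induction t with
  | zero => simp [pathE_zero, logLR]
  | succ t ih =>
    rw [pathE_succ, funext (stepE_logLR halg h0 h1 a), pathE_add, ih, pathE_mul_const,
      Finset.sum_range_succ, add_mul]

/-- Mutual information is at most the expected number of pulls of the best arm times the
divergence between the two reward laws. -/
lemma mutualInfo_le (halg : IsAlg n alg) (hn : 0 < n) (h0 : 0 < Δ) (h1 : Δ < 1) (t : ℕ) :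
    mutualInfo n t alg Δ ≤
      (n : ℝ)⁻¹ * (∑ a, ∑ s ∈ range t, pathE alg (rewP n Δ a) s fun h => alg h a) *
        (Δ * Real.log ((1 + Δ) / (1 - Δ))) := by
  have hn' : (0 : ℝ) < n := by exact_mod_cast hn
  have key : ∀ h : List (Fin n × Bool),
      ∑ a, (n : ℝ)⁻¹ * histP n alg Δ a h *
        Real.log (histP n alg Δ a h / ((n : ℝ)⁻¹ * ∑ b, histP n alg Δ b h)) ≤
      ∑ a, (n : ℝ)⁻¹ * (pathP alg (rewP n Δ a) h * logLR Δ a h) +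
        (pathP alg (baseRew n Δ) h - (n : ℝ)⁻¹ * ∑ b, pathP alg (rewP n Δ b) h) := by
    intro h
    simp only [histP_eq_pathP]
    set m := (n : ℝ)⁻¹ * ∑ b, pathP alg (rewP n Δ b) h with hm
    rcases (pathP_nonneg halg (isRew_baseRew h0 h1) h).eq_or_lt with hz | hz
    · have hz' : ∀ a, pathP alg (rewP n Δ a) h = 0 := fun a => by
        rw [pathP_rewP_eq h0 h1, ← hz, zero_mul]
      simp [hm, hz', ← hz]
    · have hpos : ∀ a, 0 < pathP alg (rewP n Δ a) h := fun a => by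
        rw [pathP_rewP_eq h0 h1]; positivity
      have : Nonempty (Fin n) := ⟨⟨0, hn⟩⟩
      have hmpos : 0 < m :=
        mul_pos (by positivity) (Finset.sum_pos (fun a _ => hpos a) Finset.univ_nonempty)
      have hle : ∀ a, (n : ℝ)⁻¹ * pathP alg (rewP n Δ a) h *
          Real.log (pathP alg (rewP n Δ a) h / m) ≤
          (n : ℝ)⁻¹ * (pathP alg (rewP n Δ a) h * logLR Δ a h) +
          (n : ℝ)⁻¹ * pathP alg (rewP n Δ a) h * (pathP alg (baseRew n Δ) h / m - 1) := by
        intro a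
        have e : Real.log (pathP alg (rewP n Δ a) h / m) =
            logLR Δ a h + Real.log (pathP alg (baseRew n Δ) h / m) := by
          rw [pathP_rewP_eq h0 h1, mul_div_right_comm, Real.log_mul (by positivity)
            (by positivity), Real.log_exp, add_comm]
        have hl := Real.log_le_sub_one_of_pos (div_pos hz hmpos)
        have hw : 0 ≤ (n : ℝ)⁻¹ * pathP alg (rewP n Δ a) h :=
          mul_nonneg (by positivity) (hpos a).le
        have := mul_le_mul_of_nonneg_left hl hw
        rw [e]
        linarith
      refine (Finset.sum_le_sum fun a _ => hle a).trans_eq ?_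
      rw [Finset.sum_add_distrib, ← Finset.sum_mul, ← Finset.mul_sum univ
        (fun a => pathP alg (rewP n Δ a) h), ← hm]
      field_simp
  have hsum : ∀ rew : Fin n → Bool → ℝ, IsRew rew →
      ∑ h : Fin t → Fin n × Bool, pathP alg rew (hist h) = 1 := fun rew hr => by
    simpa [pathE] using pathE_const halg hr t 1
  unfold mutualInfo
  rw [Finset.sum_comm]
  refine (Finset.sum_le_sum fun h _ => key (hist h)).trans_eq ?_
  rw [Finset.sum_add_distrib, Finset.sum_sub_distrib, hsum _ (isRew_baseRew h0 h1),
    ← Finset.mul_sum, Finset.sum_comm (f := fun h b => pathP alg (rewP n Δ b) (hist h)),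
    Finset.sum_congr rfl fun a _ => hsum _ (isRew_rewP h0 h1 a), Finset.sum_comm]
  have : (n : ℝ)⁻¹ * ∑ _a : Fin n, (1 : ℝ) = 1 := by simp [hn'.ne']
  rw [this, sub_self, add_zero, Finset.mul_sum, Finset.sum_mul]
  refine Finset.sum_congr rfl fun a _ => ?_
  rw [← Finset.mul_sum, mul_assoc, ← pathE_logLR halg h0 h1]
  rfl

end Information

section Walk

/-- One step of the sequential test. In state `(j, x)` with `j < k` and `x < M` arm `j` is being
tested and has score `x`; the test is passed at score `M`, and a failure at score `0` starts the
test of arm `j + 1` at score `b`. -/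
def walkStep (k b M : ℕ) (s : ℕ × ℕ) (r : Bool) : ℕ × ℕ :=
  if s.1 < k ∧ s.2 < M then
    if r then (s.1, s.2 + 1) else if s.2 = 0 then (s.1 + 1, b) else (s.1, s.2 - 1)
  else s

/-- State of the sequential test after a history. -/
def walkState {n : ℕ} (k b M : ℕ) : List (Fin n × Bool) → ℕ × ℕ
  | [] => (0, b)
  | (_, r) :: h => walkStep k b M (walkState k b M h) r

/-- The algorithm that pulls the arm under test while a test is running, pulls uniformly
afterwards, and from round `t` on plays the last tested arm. -/
def walkAlg {n : ℕ} (k b M t : ℕ) (h : List (Fin n × Bool)) (a : Fin n) : ℝ :=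
  if (walkState k b M h).1 < k ∧ ((walkState k b M h).2 < M ∨ t ≤ h.length) then
    if a.val = (walkState k b M h).1 then 1 else 0
  else (n : ℝ)⁻¹

variable {n k b M t : ℕ} {Δ : ℝ}

lemma isAlg_walkAlg (hn : 0 < n) (hk : k ≤ n) : IsAlg n (walkAlg (n := n) k b M t) := by
  intro h
  have hn' : (n : ℝ) ≠ 0 := by positivity
  refine ⟨fun a => ?_, ?_⟩
  · unfold walkAlg; split_ifs <;> positivity
  · unfold walkAlg
    split_ifs with hs
    · have : ∀ a : Fin n, (a.val = (walkState k b M h).1) =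
          (a = ⟨(walkState k b M h).1, hs.1.trans_le hk⟩) := fun a => by simp [Fin.ext_iff]
      simp [this]
    · simp [hn']

lemma stepE_walkAlg {rew : Fin n → Bool → ℝ} {φ : List (Fin n × Bool) → ℝ}
    {h : List (Fin n × Bool)} (hj : (walkState k b M h).1 < k) (hx : (walkState k b M h).2 < M)
    (hk : k ≤ n) :
    stepE (walkAlg k b M t) rew φ h =
      ∑ r, rew ⟨(walkState k b M h).1, hj.trans_le hk⟩ r *
        φ ((⟨(walkState k b M h).1, hj.trans_le hk⟩, r) :: h) := by
  have : ∀ a : Fin n, walkAlg k b M t h a =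
      if a = ⟨(walkState k b M h).1, hj.trans_le hk⟩ then 1 else 0 := fun a => by
    simp [walkAlg, hj, hx, Fin.ext_iff]
  simp [stepE, this]

lemma walkStep_of_not {s : ℕ × ℕ} (hs : ¬(s.1 < k ∧ s.2 < M)) (r : Bool) :
    walkStep k b M s r = s := if_neg hs

lemma walkStep_true {j x : ℕ} (hj : j < k) (hx : x < M) :
    walkStep k b M (j, x) true = (j, x + 1) := by simp [walkStep, hj, hx]

lemma walkStep_false_zero {j : ℕ} (hj : j < k) (hM : 0 < M) :
    walkStep k b M (j, 0) false = (j + 1, b) := by simp [walkStep, hj, hM]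

lemma walkStep_false_succ {j x : ℕ} (hj : j < k) (hx : x + 1 < M) :
    walkStep k b M (j, x + 1) false = (j, x) := by simp [walkStep, hj, hx]

/-- Probability of a success at arm `j` when `a` is the best arm. -/
def upP (Δ : ℝ) (a j : ℕ) : ℝ := if j = a then (1 + Δ) / 2 else (1 - Δ) / 2

lemma stepE_walkAlg_of_state (hk : k ≤ n) (a : Fin n) {ψ : List (Fin n × Bool) → ℝ}
    {g : ℕ × ℕ → ℝ} {h : List (Fin n × Bool)}
    (hψ : ∀ x, ψ (x :: h) = g (walkState k b M (x :: h)))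
    (hj : (walkState k b M h).1 < k) (hx : (walkState k b M h).2 < M) :
    stepE (walkAlg k b M t) (rewP n Δ a) ψ h =
      upP Δ a (walkState k b M h).1 * g (walkStep k b M (walkState k b M h) true) +
      (1 - upP Δ a (walkState k b M h).1) * g (walkStep k b M (walkState k b M h) false) := by
  rw [stepE_walkAlg hj hx hk]
  simp [hψ, rewP, upP, walkState, Fin.ext_iff]

/-- A lower bound for the probability that arm `a` passes its test, given the state `s` of the
test and the number `l` of elapsed rounds. -/
def hitPot (Δ ρ w : ℝ) (a b M l : ℕ) (s : ℕ × ℕ) : ℝ :=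
  if s.1 < a then
    if s.2 < M then
      1 / 2 - ρ ^ s.2 / ρ ^ M - (a - s.1 - 1) * (ρ ^ b / ρ ^ M) -
        w * (s.2 + 1 + (a - s.1 - 1) * (b + 1) + (M + 1) + Δ * l)
    else 0
  else if s.1 = a then
    if s.2 < M then 1 - (ρ ^ (s.2 + 1))⁻¹ - w * (M - s.2 + Δ * l) else 1
  else 0

lemma hitPot_le_step {ρ w : ℝ} {a l j x : ℕ} (h0 : 0 < Δ) (h1 : Δ < 1)
    (hρ : (1 - Δ) * ρ = 1 + Δ) (hw : 0 ≤ w) (hb : 2 ≤ ρ ^ (b + 1)) (hbM : b < M)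
    (hj : j < k) (hx : x < M) :
    hitPot Δ ρ w a b M l (j, x) ≤
      upP Δ a j * hitPot Δ ρ w a b M (l + 1) (walkStep k b M (j, x) true) +
      (1 - upP Δ a j) * hitPot Δ ρ w a b M (l + 1) (walkStep k b M (j, x) false) := by
  have hp : (0 : ℝ) < 1 - Δ := by linarith
  have hρ0 : 0 < ρ := by
    by_contra! hneg
    nlinarith
  have hρi : (1 + Δ) * ρ⁻¹ = 1 - Δ := by rw [← hρ]; field_simp
  have hl : (0 : ℝ) ≤ l := l.cast_nonneg
  have hbM' : (b : ℝ) + 1 ≤ M := by exact_mod_cast hbM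
  rw [walkStep_true hj hx]
  rcases lt_trichotomy j a with hja | hja | hja
  · have hja' : (j : ℝ) + 1 ≤ a := by exact_mod_cast hja
    set u := ρ ^ x / ρ ^ M with hu
    set u₀ := ρ ^ b / ρ ^ M with hu₀
    have hu0 : 0 < u := by positivity
    have hu₀0 : 0 < u₀ := by positivity
    have hup : 1 / 2 - ρ * u - (a - j - 1) * u₀ -
        w * (x + 2 + (a - j - 1) * (b + 1) + (M + 1) + Δ * (l + 1)) ≤
        hitPot Δ ρ w a b M (l + 1) (j, x + 1) := by
      by_cases hxM : x + 1 < M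
      · have : ρ ^ (x + 1) / ρ ^ M = ρ * u := by rw [hu, pow_succ]; ring
        simp only [hitPot, hja, hxM, if_true, this, ← hu₀]
        push_cast
        linarith
      · have hM : M = x + 1 := by omega
        have : ρ * u = 1 := by rw [hu, hM, pow_succ]; field_simp
        simp only [hitPot, hja, hxM, if_true, if_false, this]
        have t1 : 0 ≤ ((a : ℝ) - j - 1) * u₀ := mul_nonneg (by linarith) hu₀0.le
        have t2 : 0 ≤ w * (x + 2 + (a - j - 1) * (b + 1) + (M + 1) + Δ * (l + 1)) := by
          have : (0 : ℝ) ≤ a - j - 1 := by linarith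
          positivity
        linarith
    have hdown : 1 / 2 - ρ⁻¹ * u - (a - j - 1) * u₀ -
        w * (x + (a - j - 1) * (b + 1) + (M + 1) + Δ * (l + 1)) ≤
        hitPot Δ ρ w a b M (l + 1) (walkStep k b M (j, x) false) := by
      rcases x with _ | x
      · rw [walkStep_false_zero hj hx]
        have : 0 ≤ ρ⁻¹ * u := by positivity
        by_cases hj1 : j + 1 < a
        · simp only [hitPot, hj1, hbM, if_true, ← hu₀]
          push_cast
          linarith
        · have hja1 : j + 1 = a := by omega
          have hja2 : (a : ℝ) = j + 1 := by exact_mod_cast hja1.symm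
          have hinv : (ρ ^ (b + 1))⁻¹ ≤ 1 / 2 := by
            rw [one_div]; exact inv_anti₀ (by norm_num) hb
          have : w * (M - b + Δ * (l + 1)) ≤ w * (M + 1 + Δ * (l + 1)) := by
            have : (0 : ℝ) ≤ b := b.cast_nonneg
            gcongr
            linarith
          simp only [hitPot, hja1, hbM, if_true, if_false, lt_irrefl]
          push_cast
          rw [hja2]
          linarith
      · rw [walkStep_false_succ hj hx]
        have : ρ⁻¹ * u = ρ ^ x / ρ ^ M := by rw [hu, pow_succ]; field_simp
        have hxM : x < M := by omega
        simp only [hitPot, hja, hxM, if_true, this, ← hu₀]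
        push_cast
        linarith
    have hcur : hitPot Δ ρ w a b M l (j, x) = 1 / 2 - u - (a - j - 1) * u₀ -
        w * (x + 1 + (a - j - 1) * (b + 1) + (M + 1) + Δ * l) := by
      simp [hitPot, hja, hx, ← hu, ← hu₀]
    have hup' : upP Δ a j = (1 - Δ) / 2 := by simp [upP, hja.ne]
    rw [hup', hcur]
    have e1 := mul_le_mul_of_nonneg_left hup (by linarith : 0 ≤ (1 - Δ) / 2)
    have e2 := mul_le_mul_of_nonneg_left hdown (by linarith : 0 ≤ 1 - (1 - Δ) / 2)
    refine le_trans (le_of_eq ?_) (add_le_add e1 e2)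
    linear_combination (u / 2) * hρ + (u / 2) * hρi
  · subst hja
    set v := (ρ ^ (x + 1))⁻¹ with hv
    have hv0 : 0 < v := by positivity
    have hup : 1 - ρ⁻¹ * v - w * (M - x - 1 + Δ * (l + 1)) ≤
        hitPot Δ ρ w j b M (l + 1) (j, x + 1) := by
      have hxM' : (x : ℝ) + 1 ≤ M := by exact_mod_cast hx
      by_cases hxM : x + 1 < M
      · have : (ρ ^ (x + 1 + 1))⁻¹ = ρ⁻¹ * v := by rw [hv, pow_succ _ (x + 1), mul_inv, mul_comm]
        simp only [hitPot, hxM, lt_irrefl, if_true, if_false, this]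
        push_cast
        linarith
      · simp only [hitPot, hxM, lt_irrefl, if_true, if_false]
        have t1 : 0 ≤ ρ⁻¹ * v := by positivity
        have t2 : 0 ≤ w * (M - x - 1 + Δ * (l + 1)) :=
          mul_nonneg hw (by nlinarith)
        linarith
    have hdown : 1 - ρ * v - w * (M - x + 1 + Δ * (l + 1)) ≤
        hitPot Δ ρ w j b M (l + 1) (walkStep k b M (j, x) false) := by
      rcases x with _ | x
      · rw [walkStep_false_zero hj hx]
        have : ρ * v = 1 := by rw [hv, zero_add, pow_one, mul_inv_cancel₀ hρ0.ne']
        simp only [hitPot, this, Nat.not_succ_lt_self, Nat.succ_ne_self, if_false]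
        have t2 : 0 ≤ w * ((M : ℝ) - (0 : ℕ) + 1 + Δ * (l + 1)) := by
          push_cast; rw [sub_zero]; positivity
        linarith
      · rw [walkStep_false_succ hj hx]
        have : ρ * v = (ρ ^ (x + 1))⁻¹ := by rw [hv, pow_succ _ (x + 1)]; field_simp
        have hxM : x < M := by omega
        simp only [hitPot, hxM, lt_irrefl, if_true, if_false, this]
        push_cast
        linarith
    have hcur : hitPot Δ ρ w j b M l (j, x) = 1 - v - w * (M - x + Δ * l) := by
      simp [hitPot, hx, ← hv]
    have hup' : upP Δ j j = (1 + Δ) / 2 := by simp [upP]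
    rw [hup', hcur]
    have e1 := mul_le_mul_of_nonneg_left hup (by linarith : 0 ≤ (1 + Δ) / 2)
    have e2 := mul_le_mul_of_nonneg_left hdown (by linarith : 0 ≤ 1 - (1 + Δ) / 2)
    refine le_trans (le_of_eq ?_) (add_le_add e1 e2)
    linear_combination (v / 2) * hρ + (v / 2) * hρi
  · have hgt : ∀ (l : ℕ) (s : ℕ × ℕ), a < s.1 → hitPot Δ ρ w a b M l s = 0 := fun l s hs => by
      simp [hitPot, hs.not_gt, hs.ne']
    have : a < (walkStep k b M (j, x) false).1 := by
      simp only [walkStep]; split_ifs <;> simp <;> omega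
    rw [hgt _ _ hja, hgt _ _ hja, hgt _ _ this]
    simp

lemma hitPot_const {ρ w : ℝ} {a : ℕ} {s : ℕ × ℕ} (ha : a < k) (hs : ¬(s.1 < k ∧ s.2 < M))
    (l l' : ℕ) : hitPot Δ ρ w a b M l s = hitPot Δ ρ w a b M l' s := by
  by_cases hx : s.2 < M
  · have hgt : a < s.1 := by
      by_contra! h
      exact hs ⟨by omega, hx⟩
    simp [hitPot, hgt.not_gt, hgt.ne']
  · simp [hitPot, hx]

lemma hitPot_le_pathE {ρ w : ℝ} (hn : 0 < n) (hk : k ≤ n) (h0 : 0 < Δ) (h1 : Δ < 1)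
    (hρ : (1 - Δ) * ρ = 1 + Δ) (hw : 0 ≤ w) (hwt : w * (Δ * t) = 1) (hb : 2 ≤ ρ ^ (b + 1))
    (hbM : b < M) (a : Fin n) (ha : a.val < k) :
    hitPot Δ ρ w a b M 0 (0, b) ≤
      pathE (walkAlg k b M t) (rewP n Δ a) t fun h => walkAlg k b M t h a := by
  have halg : IsAlg n (walkAlg (n := n) k b M t) := isAlg_walkAlg hn hk
  have hrew := isRew_rewP h0 h1 a
  have hρ0 : 0 < ρ := by
    by_contra! hneg
    nlinarith
  refine (le_pathE_of_submartingale (t := t) halg hrew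
    (ψ := fun h => hitPot Δ ρ w a b M h.length (walkState k b M h)) fun h _ => ?_).trans
    (pathE_mono halg hrew fun h hlen => ?_)
  · by_cases hs : (walkState k b M h).1 < k ∧ (walkState k b M h).2 < M
    · rw [stepE_walkAlg_of_state hk a (g := hitPot Δ ρ w a b M (h.length + 1)) (fun x => rfl)
        hs.1 hs.2]
      exact hitPot_le_step h0 h1 hρ hw hb hbM hs.1 hs.2
    · refine (stepE_of_eq halg hrew fun x => ?_).ge
      simp only [walkState, walkStep_of_not hs]
      exact hitPot_const ha hs _ _
  · have hnn := (halg h).1 a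
    rw [hlen]
    by_cases hja : (walkState k b M h).1 < a
    · refine le_trans ?_ hnn
      have hja' : ((walkState k b M h).1 : ℝ) + 1 ≤ a.val := by exact_mod_cast hja
      simp only [hitPot, hja, if_true]
      split_ifs
      · have t0 : (0 : ℝ) ≤ a.val - (walkState k b M h).1 - 1 := by linarith
        have t1 : 0 ≤ ρ ^ (walkState k b M h).2 / ρ ^ M := by positivity
        have t2 : 0 ≤ (a.val - (walkState k b M h).1 - 1) * (ρ ^ b / ρ ^ M) := by positivity
        have t3 : 0 ≤ w * ((walkState k b M h).2 + 1 +
          (a.val - (walkState k b M h).1 - 1) * (b + 1) + (M + 1)) := by positivity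
        linarith
      · exact le_rfl
    · by_cases hja' : (walkState k b M h).1 = a
      · simp only [hitPot, hja', lt_irrefl, if_true, if_false]
        split_ifs with hx
        · refine le_trans ?_ hnn
          have hx' : ((walkState k b M h).2 : ℝ) ≤ M := by exact_mod_cast hx.le
          have t1 : 0 ≤ (ρ ^ ((walkState k b M h).2 + 1))⁻¹ := by positivity
          have t2 : 0 ≤ w * ((M : ℝ) - (walkState k b M h).2) := mul_nonneg hw (by linarith)
          linarith
        · simp [walkAlg, hja', ha, hlen]
      · simpa [hitPot, hja, hja'] using hnn

/-- An upper bound for the expected number of further pulls of arm `a` during its test. -/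
def pullPot (Δ : ℝ) (a M : ℕ) (s : ℕ × ℕ) : ℝ :=
  if s.1 < a then (M + 1) / Δ else if s.1 = a ∧ s.2 < M then (M - s.2) / Δ else 0

lemma pullPot_nonneg (h0 : 0 < Δ) (a : ℕ) (s : ℕ × ℕ) : 0 ≤ pullPot Δ a M s := by
  unfold pullPot
  split_ifs with h1 h2
  · positivity
  · have : (s.2 : ℝ) ≤ M := by exact_mod_cast h2.2.le
    exact div_nonneg (by linarith) h0.le
  · exact le_rfl

lemma pullPot_le (h0 : 0 < Δ) (a : ℕ) (s : ℕ × ℕ) : pullPot Δ a M s ≤ (M + 1) / Δ := by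
  unfold pullPot
  split_ifs with h1 h2
  · exact le_rfl
  · have : (0 : ℝ) ≤ s.2 := s.2.cast_nonneg
    gcongr
    linarith
  · positivity

lemma pullPot_step_le {a j x : ℕ} (h0 : 0 < Δ) (h1 : Δ < 1) (hj : j < k) (hx : x < M) :
    upP Δ a j * pullPot Δ a M (walkStep k b M (j, x) true) +
      (1 - upP Δ a j) * pullPot Δ a M (walkStep k b M (j, x) false) +
      (if a = j then 1 else 0) ≤ pullPot Δ a M (j, x) := by
  have hxM : (x : ℝ) + 1 ≤ M := by exact_mod_cast hx
  rcases lt_trichotomy j a with hja | hja | hja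
  · have hup : upP Δ a j = (1 - Δ) / 2 := by simp [upP, hja.ne]
    have hcur : pullPot Δ a M (j, x) = (M + 1) / Δ := by simp [pullPot, hja]
    rw [hup, hcur, if_neg hja.ne']
    have e1 := mul_le_mul_of_nonneg_left
      (pullPot_le (M := M) h0 a (walkStep k b M (j, x) true)) (by linarith : 0 ≤ (1 - Δ) / 2)
    have e2 := mul_le_mul_of_nonneg_left
      (pullPot_le (M := M) h0 a (walkStep k b M (j, x) false))
      (by linarith : 0 ≤ 1 - (1 - Δ) / 2)
    linarith
  · subst hja
    have hup : upP Δ j j = (1 + Δ) / 2 := by simp [upP]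
    have hcur : pullPot Δ j M (j, x) = (M - x) / Δ := by simp [pullPot, hx]
    have htrue : pullPot Δ j M (walkStep k b M (j, x) true) ≤ (M - x - 1) / Δ := by
      rw [walkStep_true hj hx]
      simp only [pullPot, lt_irrefl, if_false, true_and]
      split_ifs
      · push_cast; exact le_of_eq (by ring)
      · exact div_nonneg (by linarith) h0.le
    have hfalse : pullPot Δ j M (walkStep k b M (j, x) false) ≤ (M - x + 1) / Δ := by
      rcases x with _ | x
      · rw [walkStep_false_zero hj hx]
        simp [pullPot]
        positivity
      · rw [walkStep_false_succ hj hx]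
        have : x < M := by omega
        simp only [pullPot, this, lt_irrefl, if_true, if_false, and_self]
        push_cast
        exact le_of_eq (by ring)
    have e1 := mul_le_mul_of_nonneg_left htrue (by linarith : 0 ≤ (1 + Δ) / 2)
    have e2 := mul_le_mul_of_nonneg_left hfalse (by linarith : 0 ≤ 1 - (1 + Δ) / 2)
    rw [hup, hcur, if_pos rfl]
    have : (1 + Δ) / 2 * ((M - x - 1) / Δ) + (1 - (1 + Δ) / 2) * ((M - x + 1) / Δ) + 1 =
        ((M : ℝ) - x) / Δ := by field_simp; ring
    linarith
  · have hgt : ∀ s : ℕ × ℕ, a < s.1 → pullPot Δ a M s = 0 := fun s hs => by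
      simp [pullPot, hs.not_gt, hs.ne']
    have h2 : a < (walkStep k b M (j, x) false).1 := by
      simp only [walkStep]; split_ifs <;> simp <;> omega
    rw [walkStep_true hj hx, hgt (j, x + 1) hja, hgt (j, x) hja, hgt _ h2, if_neg hja.ne]
    simp

lemma expected_pulls_le (hn : 0 < n) (hk : k ≤ n) (h0 : 0 < Δ) (h1 : Δ < 1) (a : Fin n) :
    (∑ s ∈ range t, pathE (walkAlg k b M t) (rewP n Δ a) s fun h => walkAlg k b M t h a) ≤
      (if a.val < k then (M + 1) / Δ else 0) + t * (n : ℝ)⁻¹ := by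
  have halg : IsAlg n (walkAlg (n := n) k b M t) := isAlg_walkAlg hn hk
  have hrew := isRew_rewP h0 h1 a
  have hunif : ∀ h : List (Fin n × Bool), h.length < t →
      ¬((walkState k b M h).1 < k ∧ (walkState k b M h).2 < M) →
      walkAlg k b M t h a = (n : ℝ)⁻¹ := fun h hlen hs => by
    have : ¬((walkState k b M h).1 < k ∧ ((walkState k b M h).2 < M ∨ t ≤ h.length)) := by
      omega
    simp [walkAlg, this]
  have hrun : ∀ h : List (Fin n × Bool),
      ((walkState k b M h).1 < k ∧ (walkState k b M h).2 < M) →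
      walkAlg k b M t h a = if a.val = (walkState k b M h).1 then 1 else 0 := fun h hs => by
    simp [walkAlg, hs.1, hs.2]
  split_ifs with ha
  · have key := sum_pathE_le_of_drift (t := t) (v := (n : ℝ)⁻¹) halg hrew
      (ψ := fun h => pullPot Δ a M (walkState k b M h)) (φ := fun h => walkAlg k b M t h a)
      fun h hlen => ?_
    · have hnn : 0 ≤ pathE (walkAlg k b M t) (rewP n Δ a) t
          fun h => pullPot Δ a M (walkState k b M h) := by
        rw [← pathE_const halg hrew t 0]
        exact pathE_mono halg hrew fun h _ => pullPot_nonneg h0 _ _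
      have := pullPot_le (M := M) h0 a (walkState k b M ([] : List (Fin n × Bool)))
      linarith
    · by_cases hs : (walkState k b M h).1 < k ∧ (walkState k b M h).2 < M
      · rw [stepE_walkAlg_of_state hk a (g := pullPot Δ a M) (fun x => rfl) hs.1 hs.2,
          hrun h hs]
        have := pullPot_step_le (b := b) (a := a) h0 h1 hs.1 hs.2
        have hn' : (0 : ℝ) ≤ (n : ℝ)⁻¹ := by positivity
        linarith
      · rw [hunif h hlen hs, stepE_of_eq halg hrew (v := pullPot Δ a M (walkState k b M h))]
        intro x
        simp only [walkState, walkStep_of_not hs]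
  · have key := sum_pathE_le_of_drift (t := t) (v := (n : ℝ)⁻¹) halg hrew
      (ψ := fun _ => 0) (φ := fun h => walkAlg k b M t h a) fun h hlen => ?_
    · rw [pathE_const halg hrew] at key
      exact (zero_add _).symm.trans_le key
    · rw [stepE_of_eq halg hrew fun x => rfl]
      by_cases hs : (walkState k b M h).1 < k ∧ (walkState k b M h).2 < M
      · rw [hrun h hs, if_neg (by omega)]
        simp
      · rw [hunif h hlen hs]

end Walk

section Bounds

variable {n k b M t : ℕ} {Δ : ℝ}

lemma succProb_eq (alg : List (Fin n × Bool) → Fin n → ℝ) :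
    succProb n t alg Δ =
      (n : ℝ)⁻¹ * ∑ a, pathE alg (rewP n Δ a) t fun h => alg h a := by
  simp [succProb, pathE, histP_eq_pathP]

lemma mutualInfo_walkAlg_le {ε : ℝ} (hε : 0 < ε) (hn : 0 < n) (hk : k ≤ n) (h0 : 0 < Δ)
    (h1 : Δ ≤ 1 - ε) :
    mutualInfo n t (walkAlg k b M t) Δ ≤
      (n : ℝ)⁻¹ * (k * ((M + 1) / Δ) + t) * (2 * Δ ^ 2 / ε) := by
  have hΔ1 : Δ < 1 := by linarith
  have hp : 0 < 1 - Δ := by linarith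
  have hn' : (0 : ℝ) < n := by exact_mod_cast hn
  have hlog : Δ * Real.log ((1 + Δ) / (1 - Δ)) ≤ 2 * Δ ^ 2 / ε := by
    have e1 := Real.log_le_sub_one_of_pos (div_pos (by linarith : 0 < 1 + Δ) hp)
    have e2 : (1 + Δ) / (1 - Δ) - 1 = 2 * Δ / (1 - Δ) := by field_simp; ring
    have e3 : 2 * Δ / (1 - Δ) ≤ 2 * Δ / ε := by gcongr; linarith
    calc Δ * Real.log ((1 + Δ) / (1 - Δ)) ≤ Δ * (2 * Δ / ε) := by gcongr; linarith
      _ = 2 * Δ ^ 2 / ε := by ring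
  have hsum : ∑ a : Fin n, ∑ s ∈ range t, pathE (walkAlg k b M t) (rewP n Δ a) s
      (fun h => walkAlg k b M t h a) ≤ k * ((M + 1) / Δ) + t := by
    refine (Finset.sum_le_sum fun a _ => expected_pulls_le hn hk h0 hΔ1 a).trans ?_
    rw [Finset.sum_add_distrib, ← Finset.sum_filter, Finset.sum_const, Finset.sum_const,
      Fin.card_filter_val_lt, Finset.card_univ, Fintype.card_fin, min_eq_right hk,
      nsmul_eq_mul, nsmul_eq_mul]
    exact le_of_eq (by field_simp)
  have hlog0 : 0 ≤ Δ * Real.log ((1 + Δ) / (1 - Δ)) :=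
    mul_nonneg h0.le (Real.log_nonneg (by rw [le_div_iff₀ hp]; linarith))
  refine (mutualInfo_le (isAlg_walkAlg hn hk) hn h0 hΔ1 t).trans ?_
  gcongr

lemma succProb_walkAlg_zero (hn : 0 < n) (h0 : 0 < Δ) (h1 : Δ < 1) :
    succProb n t (walkAlg 0 b M t) Δ = (n : ℝ)⁻¹ := by
  have halg : IsAlg n (walkAlg (n := n) 0 b M t) := isAlg_walkAlg hn (Nat.zero_le n)
  have : ∀ (h : List (Fin n × Bool)) a, walkAlg 0 b M t h a = (n : ℝ)⁻¹ := by
    simp [walkAlg]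
  have hn' : (n : ℝ) ≠ 0 := by positivity
  simp only [succProb_eq, this, pathE_const halg (isRew_rewP h0 h1 _)]
  simp [hn']

lemma le_succProb_walkAlg {v : ℝ} (hn : 0 < n) (hk : k ≤ n) (h0 : 0 < Δ) (h1 : Δ < 1)
    (h : ∀ a : Fin n, a.val < k →
      v ≤ pathE (walkAlg k b M t) (rewP n Δ a) t fun h => walkAlg k b M t h a) :
    (n : ℝ)⁻¹ * (k * v) ≤ succProb n t (walkAlg k b M t) Δ := by
  have halg : IsAlg n (walkAlg (n := n) k b M t) := isAlg_walkAlg hn hk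
  rw [succProb_eq]
  gcongr
  have : (k : ℝ) * v = ∑ a : Fin n, if a.val < k then v else 0 := by
    rw [← Finset.sum_filter, Finset.sum_const, Fin.card_filter_val_lt, min_eq_right hk,
      nsmul_eq_mul]
  rw [this]
  refine Finset.sum_le_sum fun a _ => ?_
  split_ifs with ha
  · exact h a ha
  · rw [← pathE_const halg (isRew_rewP h0 h1 a) t 0]
    exact pathE_mono halg (isRew_rewP h0 h1 a) fun h _ => (halg h).1 a

lemma quarter_le_hitPot {ρ : ℝ} {a : ℕ} (h0 : 0 < Δ) (h1 : Δ < 1) (hρ0 : 0 < ρ)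
    (ha : a < k) (hkt : 128 * k ≤ t * Δ ^ 2) (hb : 2 ≤ ρ ^ (b + 1)) (hbΔ : Δ * (b + 1) ≤ 3)
    (hbM : b < M) (hM : Δ * (M + 1) ≤ 8 * k + 4) (hρM : ρ ^ b / ρ ^ M ≤ (8 * k : ℝ)⁻¹) :
    1 / 4 ≤ hitPot Δ ρ (1 / (Δ * t)) a b M 0 (0, b) := by
  have hk1 : (1 : ℝ) ≤ k := by exact_mod_cast (by omega : 1 ≤ k)
  have hτ : 0 < t * Δ ^ 2 := by linarith
  have ht : (0 : ℝ) < t := pos_of_mul_pos_left hτ (by positivity)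
  have hak : (a : ℝ) + 1 ≤ k := by exact_mod_cast ha
  have hw : ∀ y : ℝ, 1 / (Δ * t) * y = Δ * y / (t * Δ ^ 2) := fun y => by field_simp
  have hM8 : Δ * (M + 1) / (t * Δ ^ 2) ≤ 12 / 128 := by
    rw [div_le_iff₀ hτ]; linarith
  rcases Nat.eq_zero_or_pos a with rfl | ha0
  · have hinv : (ρ ^ (b + 1))⁻¹ ≤ 1 / 2 := by
      rw [one_div]; exact inv_anti₀ (by norm_num) hb
    have : Δ * (M - b + Δ * (0 : ℕ)) / (t * Δ ^ 2) ≤ Δ * (M + 1) / (t * Δ ^ 2) := by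
      have : (0 : ℝ) ≤ b := b.cast_nonneg
      rw [Nat.cast_zero, mul_zero, add_zero]
      gcongr
      linarith
    simp only [hitPot, lt_irrefl, if_false, hbM, if_true, hw]
    linarith
  · have ha0' : (1 : ℝ) ≤ a := by exact_mod_cast ha0
    simp only [hitPot, ha0, hbM, if_true, hw]
    have e1 : (a : ℝ) * (ρ ^ b / ρ ^ M) ≤ 1 / 8 := by
      calc (a : ℝ) * (ρ ^ b / ρ ^ M) ≤ k * (8 * k : ℝ)⁻¹ := by
            gcongr
        _ = 1 / 8 := by field_simp
    have e2 : Δ * (b + 1 + (a - (0 : ℕ) - 1) * (b + 1) + (M + 1) + Δ * (0 : ℕ)) /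
        (t * Δ ^ 2) ≤ 1 / 8 := by
      rw [div_le_iff₀ hτ]
      have : (a : ℝ) * (Δ * (b + 1)) ≤ k * 3 := by gcongr
      push_cast
      linarith
    push_cast at e2 ⊢
    linarith

lemma exists_walk_params (h0 : 0 < Δ) (h1 : Δ < 1) {K : ℝ} (hK : 1 < K) :
    ∃ b M : ℕ, b < M ∧ 2 ≤ ((1 + Δ) / (1 - Δ)) ^ (b + 1) ∧ Δ * (b + 1) ≤ 3 ∧
      Δ * (M + 1) ≤ Real.log K + 4 ∧
      ((1 + Δ) / (1 - Δ)) ^ b / ((1 + Δ) / (1 - Δ)) ^ M ≤ K⁻¹ := by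
  have hp : 0 < 1 - Δ := by linarith
  set ρ := (1 + Δ) / (1 - Δ) with hρ
  have hρ0 : 0 < ρ := by positivity
  have hexp : Real.exp Δ ≤ ρ := by
    have e1 : 1 - Δ ≤ Real.exp (-Δ) := by linarith [Real.add_one_le_exp (-Δ)]
    rw [hρ, le_div_iff₀ hp]
    calc Real.exp Δ * (1 - Δ) ≤ Real.exp Δ * Real.exp (-Δ) := by gcongr
      _ = 1 := by rw [← Real.exp_add, add_neg_cancel, Real.exp_zero]
      _ ≤ 1 + Δ := by linarith
  have hpow : ∀ m : ℕ, Real.exp (Δ * m) ≤ ρ ^ m := fun m => by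
    rw [mul_comm, Real.exp_nat_mul]
    exact pow_le_pow_left₀ (Real.exp_pos _).le hexp m
  have hlogK : 0 < Real.log K := Real.log_pos hK
  have hb1 := Nat.le_ceil (1 / Δ)
  have hb2 := Nat.ceil_lt_add_one (by positivity : 0 ≤ 1 / Δ)
  have hB1 := Nat.le_ceil (Real.log K / Δ)
  have hB2 := Nat.ceil_lt_add_one (by positivity : 0 ≤ Real.log K / Δ)
  have hBpos : 0 < ⌈Real.log K / Δ⌉₊ := Nat.ceil_pos.2 (by positivity)
  set b := ⌈1 / Δ⌉₊
  set B := ⌈Real.log K / Δ⌉₊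
  rw [div_le_iff₀ h0] at hb1 hB1
  have hb3 : Δ * b < 1 + Δ := by
    calc Δ * b < Δ * (1 / Δ + 1) := by gcongr
      _ = 1 + Δ := by field_simp
  have hB3 : Δ * B < Real.log K + Δ := by
    calc Δ * B < Δ * (Real.log K / Δ + 1) := by gcongr
      _ = Real.log K + Δ := by field_simp
  refine ⟨b, b + B, by omega, ?_, by linarith, by push_cast; linarith, ?_⟩
  · refine le_trans ?_ (hpow (b + 1))
    push_cast
    linarith [Real.add_one_le_exp (Δ * (b + 1))]
  · rw [pow_add, div_mul_cancel_left₀ (by positivity)]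
    refine inv_anti₀ (by linarith) (le_trans ?_ (hpow B))
    rw [← Real.log_le_iff_le_exp (by linarith)]
    linarith

end Bounds

end BanditWalk

/-- An optimal algorithm with suboptimal mutual information: for every `ε ∈ (0,1)` there are
`c > 0` and `C > 0` such that for all `n ≥ 2`, `Δ ∈ (0, 1-ε]` and horizons `t ≤ n/Δ²`, there
is an interactive algorithm whose success probability is at least `c (1 + tΔ²)/n` while its
mutual information is at most `C (1 + tΔ²) log(2 + tΔ²) / n`. -/
theorem bandit_optimal_alg_suboptimal_info :
    ∀ ε : ℝ, ε ∈ Set.Ioo (0 : ℝ) 1 → ∃ c C : ℝ, 0 < c ∧ 0 < C ∧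
      ∀ n : ℕ, 2 ≤ n → ∀ Δ : ℝ, Δ ∈ Set.Ioc (0 : ℝ) (1 - ε) →
        ∀ t : ℕ, (t : ℝ) ≤ (n : ℝ) / Δ ^ 2 →
          ∃ alg, IsAlg n alg ∧
            c * (1 + t * Δ ^ 2) / n ≤ succProb n t alg Δ ∧
            mutualInfo n t alg Δ ≤
              C * (1 + t * Δ ^ 2) * Real.log (2 + t * Δ ^ 2) / n := by
  intro ε hε
  refine ⟨1 / 2048, 22 / ε, by norm_num, div_pos (by norm_num) hε.1, ?_⟩
  intro n hn Δ hΔ t ht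
  have hε0 := hε.1
  have h0 := hΔ.1
  have h1 : Δ < 1 := by linarith [hΔ.2]
  have hn0 : 0 < n := by omega
  have hn' : (0 : ℝ) < n := by exact_mod_cast hn0
  have hτn : t * Δ ^ 2 ≤ n := by rwa [le_div_iff₀ (by positivity)] at ht
  have hτ0 : 0 ≤ t * Δ ^ 2 := by positivity
  have hL : 1 / 2 ≤ Real.log (2 + t * Δ ^ 2) :=
    le_trans (b := Real.log 2) (by linarith [Real.log_two_gt_d9]) (Real.log_le_log (by norm_num) (by linarith))
  have hinfo : ∀ k b M : ℕ, k ≤ n →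
      k * (Δ * (M + 1)) ≤ 9 * (t * Δ ^ 2) * Real.log (2 + t * Δ ^ 2) →
      mutualInfo n t (walkAlg k b M t) Δ ≤
        22 / ε * (1 + t * Δ ^ 2) * Real.log (2 + t * Δ ^ 2) / n := by
    intro k b M hk hkM
    refine (mutualInfo_walkAlg_le hε0 hn0 hk h0 hΔ.2).trans ?_
    have e1 : (n : ℝ)⁻¹ * (k * ((M + 1) / Δ) + t) * (2 * Δ ^ 2 / ε) =
        2 * (k * (Δ * (M + 1)) + t * Δ ^ 2) / ε / n := by field_simp
    have e2 : 22 / ε * (1 + t * Δ ^ 2) * Real.log (2 + t * Δ ^ 2) / n =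
        22 * (1 + t * Δ ^ 2) * Real.log (2 + t * Δ ^ 2) / ε / n := by ring
    rw [e1, e2]
    gcongr ?_ / ε / n
    nlinarith
  rcases lt_or_ge (t * Δ ^ 2) 128 with hτ | hτ
  · refine ⟨walkAlg 0 0 0 t, isAlg_walkAlg hn0 (Nat.zero_le n), ?_,
      hinfo 0 0 0 (Nat.zero_le n) (by simp; positivity)⟩
    rw [succProb_walkAlg_zero hn0 h0 h1, inv_eq_one_div]
    gcongr
    linarith
  · set k := ⌊t * Δ ^ 2 / 128⌋₊
    have hk1 : 1 ≤ k := Nat.le_floor (by push_cast; linarith)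
    have hk1' : (1 : ℝ) ≤ k := by exact_mod_cast hk1
    have hkle : (k : ℝ) ≤ t * Δ ^ 2 / 128 := Nat.floor_le (by positivity)
    have hklt : t * Δ ^ 2 / 128 < k + 1 := Nat.lt_floor_add_one _
    have hkn : k ≤ n := by
      have : (k : ℝ) ≤ n := by linarith
      exact_mod_cast this
    have hp : 0 < 1 - Δ := by linarith
    obtain ⟨b, M, hbM, hb, hbΔ, hM, hρM⟩ :=
      exists_walk_params h0 h1 (by linarith : (1 : ℝ) < 8 * k)
    have ht0 : (0 : ℝ) < t := pos_of_mul_pos_left (by linarith : 0 < t * Δ ^ 2) (by positivity)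
    refine ⟨walkAlg k b M t, isAlg_walkAlg hn0 hkn, ?_, hinfo k b M hkn ?_⟩
    · refine le_trans ?_ (le_succProb_walkAlg (v := 1 / 4) hn0 hkn h0 h1 fun a ha => ?_)
      · rw [div_eq_inv_mul]
        refine mul_le_mul_of_nonneg_left ?_ (by positivity)
        linarith
      · have hlog : Real.log (8 * k) ≤ 8 * k := Real.log_le_self (by positivity)
        refine (quarter_le_hitPot (t := t) h0 h1 (by positivity) ha (by linarith) hb hbΔ hbM
          (by linarith) hρM).trans
          (hitPot_le_pathE hn0 hkn h0 h1 (by field_simp) (by positivity) (by field_simp) hb hbM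
            a ha)
    · have hlog : Real.log (8 * k) ≤ Real.log (2 + t * Δ ^ 2) :=
        Real.log_le_log (by positivity) (by linarith)
      calc k * (Δ * (M + 1)) ≤ t * Δ ^ 2 / 128 * (9 * Real.log (2 + t * Δ ^ 2)) := by
            refine mul_le_mul hkle (by linarith) (by positivity) (by positivity)
        _ ≤ 9 * (t * Δ ^ 2) * Real.log (2 + t * Δ ^ 2) := by
            have : 0 ≤ (t * Δ ^ 2) * Real.log (2 + t * Δ ^ 2) := by positivity
            linarith
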